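/- Let τ be a critical Galton–Watson tree with offspring distribution p, and let A : 𝕋_0 → ℤ_+ be a functional satisfying the monotonicity property: A(t_(b),i) ≤ A(t) for every finite tree t, every b ∈ ℕ and every 1 ≤ i ≤ Y_b(t). Assume P[A(τ) > n] > 0 for all n ∈ ℕ. Then, as n → ∞, τ conditioned on {A(τ) > n} converges locally in distribution to the immortal tree τ*: for every h ∈ ℕ and every tree t of height at most h, lim_{n→∞} P[r_h(τ) = t | A(τ) > n] = P[r_h(τ*) = t]. -/

import Mathlib

open MeasureTheory Filter Set ProbabilityTheory
open scoped ENNReal Topology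

namespace GWLocal

/-- Nodes of trees: finite sequences of positive integers. -/
abbrev Node : Type := List ℕ+

/-- A (rooted planar) tree, as a subset of the set `U` of finite sequences of positive
integers: it contains the root `[]`, is closed under taking prefixes, and the children of
any node `u` form an initial segment `u1, …, uk` for some `k ∈ ℤ₊` (the out-degree of `u`). -/
def IsTree (t : Set Node) : Prop :=
  (([] : Node) ∈ t) ∧
  (∀ u ∈ t, ∀ v : Node, v <+: u → v ∈ t) ∧
  (∀ u ∈ t, ∃ k : ℕ, ∀ i : ℕ+, (u ++ [i]) ∈ t ↔ (i : ℕ) ≤ k)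

/-- The out-degree `k_u(t)` of the node `u` in the tree `t`. -/
noncomputable def deg (t : Set Node) (u : Node) : ℕ := {i : ℕ+ | (u ++ [i]) ∈ t}.ncard

/-- `restrict h t = r_h(t)`, the tree `t` restricted below height `h`. -/
def restrict (h : ℕ) (t : Set Node) : Set Node := {u ∈ t | u.length ≤ h}

/-- `Y h t = Y_h(t)`, the number of nodes of `t` at height `h`. -/
noncomputable def Y (h : ℕ) (t : Set Node) : ℕ := {u ∈ t | u.length = h}.ncard

/-- The height `H(t) = sup{|u| : u ∈ t}` of a tree. -/
noncomputable def height (t : Set Node) : ℕ∞ := ⨆ u ∈ t, (u.length : ℕ∞)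

/-- The width `W(t) = sup_{h ∈ ℤ₊} Y_h(t)` of a tree. -/
noncomputable def width (t : Set Node) : ℕ∞ := ⨆ h : ℕ, (Y h t : ℕ∞)

/-- The subtree of `t` above the node `u`, re-rooted at `u`. -/
def subtreeAt (t : Set Node) (u : Node) : Set Node := {v | u ++ v ∈ t}

/-- The mean `μ = Σ_k k p_k` of an offspring distribution `p`. -/
noncomputable def mean (p : PMF ℕ) : ℝ≥0∞ := ∑' k : ℕ, (k : ℝ≥0∞) * p k

/-- `∏_{u ∈ t, |u| < h} p_{k_u(t)}`: the probability that a GW tree with offspring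
distribution `p`, restricted below height `h`, equals `t`. -/
noncomputable def cylProb (p : PMF ℕ) (h : ℕ) (t : Set Node) : ℝ≥0∞ :=
  ∏ᶠ u ∈ {u ∈ t | u.length < h}, p (deg t u)

/-- `μ^{-b} Y_b(t) ∏_{u ∈ t, |u| < b} p_{k_u(t)}`: the probability that Kesten's immortal
tree `τ*` associated with `p`, restricted below height `b`, equals `t`. -/
noncomputable def kesten (p : PMF ℕ) (b : ℕ) (t : Set Node) : ℝ≥0∞ :=
  ((mean p)⁻¹) ^ b * (Y b t : ℝ≥0∞) * cylProb p b t

/-- The σ-algebra on the space of trees generated by the events `{t : r_h(t) = s}`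
(the Borel σ-algebra of the local ultrametric on trees). -/
def treeσ : MeasurableSpace (Set Node) :=
  MeasurableSpace.generateFrom
    {S : Set (Set Node) | ∃ (h : ℕ) (s : Set Node), S = {t | restrict h t = s}}

/-- `τ` is a Galton–Watson tree with offspring distribution `p` under `P`:
it takes values in trees, is measurable, and for every `h ∈ ℕ = {1,2,…}` and every tree `t`
of height at most `h`, `P[r_h(τ) = t] = ∏_{u ∈ t, |u| < h} p_{k_u(t)}`. -/
def IsGW {Ω : Type*} [MeasurableSpace Ω] (P : Measure Ω) (p : PMF ℕ)
    (τ : Ω → Set Node) : Prop :=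
  (∀ ω, IsTree (τ ω)) ∧ (@Measurable Ω (Set Node) _ treeσ τ) ∧
  (∀ h : ℕ, 1 ≤ h → ∀ t : Set Node, IsTree t → height t ≤ (h : ℕ∞) →
    P {ω | restrict h (τ ω) = t} = cylProb p h t)

/-! ### Grafting trees onto a common root -/

/-- The trees `f 0, …, f (k - 1)`, hung in this order below the root (which is left out). -/
def branches (k : ℕ) (f : Fin k → Set Node) : Set Node :=
  ⋃ i : Fin k, (fun v : Node => Nat.succPNat i :: v) '' f i

/-- The tree whose root has the `k` subtrees `f 0, …, f (k - 1)`. -/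
def graft (k : ℕ) (f : Fin k → Set Node) : Set Node :=
  insert [] (branches k f)

theorem ncard_setOf_pnat_le (k : ℕ) : {i : ℕ+ | (i : ℕ) ≤ k}.ncard = k := by
  have : {i : ℕ+ | (i : ℕ) ≤ k} = Set.range (fun i : Fin k => Nat.succPNat i) := by
    ext i
    simp only [Set.mem_ofPred_eq, Set.mem_range]
    constructor
    · intro h
      refine ⟨⟨i.natPred, by have := PNat.natPred_add_one i; omega⟩, PNat.succPNat_natPred i⟩
    · rintro ⟨j, rfl⟩
      simp [Nat.succPNat_coe]
  rw [this]
  have := Nat.card_range_of_injective (f := fun i : Fin k => Nat.succPNat i)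
    (fun a b hab => Fin.ext (Nat.succPNat_injective hab))
  rw [Nat.card_fin] at this
  exact this

theorem deg_eq {t : Set Node} {u : Node} {k : ℕ}
    (h : ∀ i : ℕ+, u ++ [i] ∈ t ↔ (i : ℕ) ≤ k) : deg t u = k := by
  simp only [deg, h, ncard_setOf_pnat_le]

theorem IsTree.append_mem_iff {t : Set Node} (ht : IsTree t) {u : Node} (hu : u ∈ t) (i : ℕ+) :
    u ++ [i] ∈ t ↔ (i : ℕ) ≤ deg t u := by
  obtain ⟨k, hk⟩ := ht.2.2 u hu
  rw [deg_eq hk, hk]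

theorem nil_mem_graft (k : ℕ) (f : Fin k → Set Node) : ([] : Node) ∈ graft k f :=
  Set.mem_insert _ _

theorem nil_notMem_branches (k : ℕ) (f : Fin k → Set Node) : ([] : Node) ∉ branches k f := by
  simp [branches]

theorem cons_mem_branches {k : ℕ} {f : Fin k → Set Node} {a : ℕ+} {v : Node} :
    a :: v ∈ branches k f ↔ ∃ i : Fin k, a = Nat.succPNat i ∧ v ∈ f i := by
  simp only [branches, Set.mem_iUnion, Set.mem_image, List.cons.injEq]
  constructor
  · rintro ⟨i, w, hw, rfl, rfl⟩
    exact ⟨i, rfl, hw⟩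
  · rintro ⟨i, rfl, hv⟩
    exact ⟨i, v, hv, rfl, rfl⟩

theorem cons_mem_graft {k : ℕ} {f : Fin k → Set Node} {a : ℕ+} {v : Node} :
    a :: v ∈ graft k f ↔ ∃ i : Fin k, a = Nat.succPNat i ∧ v ∈ f i := by
  simp [graft, cons_mem_branches]

theorem succPNat_cons_mem_graft {k : ℕ} {f : Fin k → Set Node} {i : Fin k} {v : Node} :
    Nat.succPNat i :: v ∈ graft k f ↔ v ∈ f i := by
  rw [cons_mem_graft]
  constructor
  · rintro ⟨j, hj, hv⟩
    rwa [Fin.ext (Nat.succPNat_injective hj)]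
  · exact fun hv => ⟨i, rfl, hv⟩

theorem deg_graft_nil {k : ℕ} {f : Fin k → Set Node} (hf : ∀ i, ([] : Node) ∈ f i) :
    deg (graft k f) [] = k := by
  apply deg_eq
  intro a
  rw [List.nil_append, cons_mem_graft]
  constructor
  · rintro ⟨i, rfl, -⟩
    simp [Nat.succPNat_coe]
  · intro h
    exact ⟨⟨a.natPred, by have := PNat.natPred_add_one a; omega⟩,
      (PNat.succPNat_natPred a).symm, hf _⟩

theorem subtreeAt_graft (k : ℕ) (f : Fin k → Set Node) (i : Fin k) (v : Node) :
    subtreeAt (graft k f) (Nat.succPNat i :: v) = subtreeAt (f i) v := by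
  ext w
  exact succPNat_cons_mem_graft

theorem subtreeAt_nil (t : Set Node) : subtreeAt t [] = t := rfl

theorem deg_graft_cons (k : ℕ) (f : Fin k → Set Node) (i : Fin k) (v : Node) :
    deg (graft k f) (Nat.succPNat i :: v) = deg (f i) v := by
  simp only [deg, List.cons_append, succPNat_cons_mem_graft]

theorem IsTree.graft {k : ℕ} {f : Fin k → Set Node} (hf : ∀ i, IsTree (f i)) :
    IsTree (graft k f) := by
  refine ⟨nil_mem_graft k f, ?_, ?_⟩
  · rintro u hu v hv
    cases v with
    | nil => exact nil_mem_graft k f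
    | cons a v =>
      obtain ⟨w, rfl⟩ := hv
      obtain ⟨i, rfl, hi⟩ := cons_mem_graft.1 hu
      exact succPNat_cons_mem_graft.2 ((hf i).2.1 _ hi _ (List.prefix_append v w))
  · rintro u hu
    cases u with
    | nil =>
      refine ⟨k, fun a => ?_⟩
      rw [List.nil_append, cons_mem_graft]
      constructor
      · rintro ⟨i, rfl, -⟩
        simp [Nat.succPNat_coe]
      · intro h
        exact ⟨⟨a.natPred, by have := PNat.natPred_add_one a; omega⟩,
          (PNat.succPNat_natPred a).symm, (hf _).1⟩
    | cons a v =>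
      obtain ⟨i, rfl, hi⟩ := cons_mem_graft.1 hu
      obtain ⟨m, hm⟩ := (hf i).2.2 v hi
      exact ⟨m, fun b => by rw [List.cons_append, succPNat_cons_mem_graft, hm]⟩

theorem finite_branches {k : ℕ} {f : Fin k → Set Node} (hf : ∀ i, (f i).Finite) :
    (branches k f).Finite :=
  Set.finite_iUnion fun i => (hf i).image _

theorem finite_graft {k : ℕ} {f : Fin k → Set Node} (hf : ∀ i, (f i).Finite) :
    (graft k f).Finite :=
  (finite_branches hf).insert _

theorem IsTree.subtreeAt {t : Set Node} (ht : IsTree t) {u : Node} (hu : u ∈ t) :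
    IsTree (subtreeAt t u) := by
  refine ⟨by simpa [GWLocal.subtreeAt] using hu, fun v hv w hw => ?_, fun v hv => ?_⟩
  · exact ht.2.1 _ hv _ ((List.prefix_append_right_inj u).2 hw)
  · obtain ⟨m, hm⟩ := ht.2.2 _ hv
    refine ⟨m, fun i => ?_⟩
    rw [← hm, List.append_assoc]
    rfl

theorem finite_subtreeAt {t : Set Node} (ht : t.Finite) (u : Node) : (subtreeAt t u).Finite :=
  ht.preimage (List.append_right_injective u).injOn

theorem IsTree.singleton_mem {t : Set Node} (ht : IsTree t) (i : Fin (deg t [])) :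
    [Nat.succPNat i] ∈ t := by
  have := (ht.append_mem_iff ht.1 (Nat.succPNat i)).2 (by simp [Nat.succPNat_coe])
  simpa using this

theorem IsTree.graft_subtreeAt {t : Set Node} (ht : IsTree t) :
    GWLocal.graft (deg t []) (fun i => GWLocal.subtreeAt t [Nat.succPNat i]) = t := by
  ext u
  cases u with
  | nil => simp [nil_mem_graft, ht.1]
  | cons a v =>
    rw [cons_mem_graft]
    constructor
    · rintro ⟨i, rfl, hv⟩
      exact hv
    · intro h
      have ha : [a] ∈ t := ht.2.1 _ h _ ⟨v, rfl⟩
      have hle := (ht.append_mem_iff ht.1 a).1 ha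
      exact ⟨⟨a.natPred, by have := PNat.natPred_add_one a; omega⟩,
        (PNat.succPNat_natPred a).symm, by
          simpa [GWLocal.subtreeAt, PNat.succPNat_natPred] using h⟩

theorem graft_injective (k : ℕ) : Function.Injective (graft k) := by
  intro f g h
  funext i
  ext v
  rw [← succPNat_cons_mem_graft (f := f), h, succPNat_cons_mem_graft]

/-! ### Restrictions -/

theorem IsTree.restrict {t : Set Node} (ht : IsTree t) (h : ℕ) : IsTree (restrict h t) := by
  refine ⟨⟨ht.1, Nat.zero_le _⟩, fun u hu v hv => ⟨ht.2.1 u hu.1 v hv, hv.length_le.trans hu.2⟩,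
    fun u hu => ?_⟩
  obtain ⟨k, hk⟩ := ht.2.2 u hu.1
  by_cases hl : u.length < h
  · refine ⟨k, fun i => ?_⟩
    rw [← hk]
    exact ⟨fun H => H.1, fun H => ⟨H, by simpa using hl⟩⟩
  · refine ⟨0, fun i => ?_⟩
    constructor
    · intro H
      have := H.2
      simp at this
      omega
    · intro H
      have := i.pos
      omega

theorem restrict_graft (h k : ℕ) (f : Fin k → Set Node) :
    restrict (h + 1) (graft k f) = graft k (fun i => restrict h (f i)) := by
  ext u
  cases u with
  | nil => simp [restrict, nil_mem_graft]
  | cons a v =>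
    simp only [restrict, Set.mem_ofPred_eq, cons_mem_graft, List.length_cons, add_le_add_iff_right]
    constructor
    · rintro ⟨⟨i, rfl, hi⟩, hl⟩
      exact ⟨i, rfl, hi, hl⟩
    · rintro ⟨i, rfl, hi, hl⟩
      exact ⟨⟨i, rfl, hi⟩, hl⟩

theorem restrict_eq_self {t : Set Node} {h : ℕ} :
    restrict h t = t ↔ ∀ u ∈ t, u.length ≤ h := by
  simp [restrict]

theorem height_le_iff {t : Set Node} {h : ℕ} :
    height t ≤ (h : ℕ∞) ↔ ∀ u ∈ t, u.length ≤ h := by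
  simp [height]

theorem IsTree.finite_of_length_le {t : Set Node} (ht : IsTree t) {h : ℕ}
    (hh : ∀ u ∈ t, u.length ≤ h) : t.Finite := by
  have level : ∀ n : ℕ, {u ∈ t | u.length = n}.Finite := by
    intro n
    induction n with
    | zero =>
      refine (Set.finite_singleton ([] : Node)).subset ?_
      rintro u ⟨-, hu⟩
      exact List.length_eq_zero_iff.1 hu
    | succ n ih =>
      have hsub : {u ∈ t | u.length = n + 1} ⊆
          ⋃ u ∈ {u ∈ t | u.length = n},
            (fun i : ℕ+ => u ++ [i]) '' {i : ℕ+ | (i : ℕ) ≤ deg t u} := by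
        rintro u ⟨hu, hl⟩
        have hne : u ≠ [] := by
          rintro rfl
          simp at hl
        have hsplit := List.dropLast_append_getLast hne
        have hd : u.dropLast ∈ t := ht.2.1 u hu _ (List.dropLast_prefix u)
        refine Set.mem_biUnion (x := u.dropLast) ⟨hd, by simp [hl]⟩ ⟨u.getLast hne, ?_, hsplit⟩
        rw [Set.mem_ofPred_eq, ← ht.append_mem_iff hd, hsplit]
        exact hu
      refine (ih.biUnion fun u _ => Set.Finite.image _ ?_).subset hsub
      exact (Set.finite_Iic (deg t u)).preimage PNat.coe_injective.injOn
  refine ((Set.finite_Iic h).biUnion fun n _ => level n).subset fun u hu => ?_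
  exact Set.mem_biUnion (x := u.length) (hh u hu) ⟨hu, rfl⟩

theorem exists_length_lt {t : Set Node} (ht : t.Finite) : ∃ N : ℕ, ∀ u ∈ t, u.length < N := by
  obtain ⟨M, hM⟩ := (ht.image List.length).bddAbove
  exact ⟨M + 1, fun u hu => Nat.lt_succ_of_le (hM ⟨u, hu, rfl⟩)⟩

theorem IsTree.eq_of_restrict_eq {t s : Set Node} (ht : IsTree t) {N : ℕ}
    (hs : ∀ u ∈ s, u.length < N) (h : GWLocal.restrict N t = s) : t = s := by
  have hlt : ∀ u ∈ t, u.length ≤ N := by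
    intro u hu
    by_contra! hlong
    have hmem : u.take N ∈ s := by
      rw [← h]
      exact ⟨ht.2.1 u hu _ (List.take_prefix N u), by simp⟩
    have := hs _ hmem
    simp at this
    omega
  rw [← h, restrict_eq_self.2 hlt]

/-! ### Products over the nodes of a grafted tree -/

@[to_additive]
theorem finprod_mem_branches {M : Type*} [CommMonoid M] {k : ℕ} {f : Fin k → Set Node}
    (hf : ∀ i, (f i).Finite) (F : Node → M) :
    ∏ᶠ u ∈ branches k f, F u = ∏ i, ∏ᶠ v ∈ f i, F (Nat.succPNat i :: v) := by
  rw [branches, finprod_mem_iUnion, finprod_eq_prod_of_fintype]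
  · refine Finset.prod_congr rfl fun i _ => ?_
    exact finprod_mem_image fun a _ b _ hab => (List.cons.inj hab).2
  · intro i j hij
    rw [Function.onFun, Set.disjoint_left]
    rintro _ ⟨v, -, rfl⟩ ⟨w, -, hw⟩
    exact hij (Fin.ext (Nat.succPNat_injective (List.cons.inj hw).1.symm))
  · exact fun i => (hf i).image _

theorem finprod_mem_graft {M : Type*} [CommMonoid M] {k : ℕ} {f : Fin k → Set Node}
    (hf : ∀ i, (f i).Finite) (F : Node → M) :
    ∏ᶠ u ∈ graft k f, F u = F [] * ∏ i, ∏ᶠ v ∈ f i, F (Nat.succPNat i :: v) := by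
  rw [graft, finprod_mem_insert _ (nil_notMem_branches k f) (finite_branches hf),
    finprod_mem_branches hf]

theorem graft_length_lt_succ (h k : ℕ) (f : Fin k → Set Node) :
    {u ∈ graft k f | u.length < h + 1} = graft k (fun i => {v ∈ f i | v.length < h}) := by
  ext u
  cases u with
  | nil => simp [nil_mem_graft]
  | cons a v =>
    simp only [Set.mem_ofPred_eq, cons_mem_graft, List.length_cons, add_lt_add_iff_right]
    constructor
    · rintro ⟨⟨i, rfl, hi⟩, hl⟩
      exact ⟨i, rfl, hi, hl⟩
    · rintro ⟨i, rfl, hi, hl⟩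
      exact ⟨⟨i, rfl, hi⟩, hl⟩

theorem graft_length_eq_succ (h k : ℕ) (f : Fin k → Set Node) :
    {u ∈ graft k f | u.length = h + 1} = branches k (fun i => {v ∈ f i | v.length = h}) := by
  ext u
  cases u with
  | nil => simp [nil_notMem_branches]
  | cons a v =>
    simp only [Set.mem_ofPred_eq, cons_mem_graft, cons_mem_branches, List.length_cons,
      add_left_inj]
    constructor
    · rintro ⟨⟨i, rfl, hi⟩, hl⟩
      exact ⟨i, rfl, hi, hl⟩
    · rintro ⟨i, rfl, hi, hl⟩
      exact ⟨⟨i, rfl, hi⟩, hl⟩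

theorem IsTree.length_eq_zero {t : Set Node} (ht : IsTree t) :
    {u ∈ t | u.length = 0} = {[]} := by
  ext u
  simp only [Set.mem_ofPred_eq, List.length_eq_zero_iff, Set.mem_singleton_iff]
  exact ⟨fun H => H.2, fun H => ⟨H ▸ ht.1, H⟩⟩

theorem IsTree.Y_zero {t : Set Node} (ht : IsTree t) : Y 0 t = 1 := by
  rw [Y, ht.length_eq_zero, Set.ncard_singleton]

theorem Y_succ_graft (h : ℕ) {k : ℕ} {f : Fin k → Set Node} (hf : ∀ i, (f i).Finite) :
    Y (h + 1) (graft k f) = ∑ i, Y h (f i) := by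
  have hY : ∀ (n : ℕ) (t : Set Node), Y n t = ∑ᶠ u ∈ {u ∈ t | u.length = n}, 1 :=
    fun n t => finsum_one.symm
  simp only [hY]
  rw [graft_length_eq_succ, finsum_mem_branches fun i => (hf i).subset (Set.sep_subset _ _)]

theorem cylProb_succ_graft (p : PMF ℕ) (h : ℕ) {k : ℕ} {f : Fin k → Set Node}
    (hf : ∀ i, (f i).Finite) (hroot : ∀ i, ([] : Node) ∈ f i) :
    cylProb p (h + 1) (graft k f) = p k * ∏ i, cylProb p h (f i) := by
  rw [cylProb, graft_length_lt_succ,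
    finprod_mem_graft fun i => (hf i).subset (Set.sep_subset _ _), deg_graft_nil hroot]
  simp only [deg_graft_cons, cylProb]

/-- The probability that a GW tree with offspring distribution `p` equals the finite tree `t`. -/
noncomputable def treeProb (p : PMF ℕ) (t : Set Node) : ℝ≥0∞ := ∏ᶠ u ∈ t, p (deg t u)

theorem treeProb_graft (p : PMF ℕ) {k : ℕ} {f : Fin k → Set Node}
    (hf : ∀ i, (f i).Finite) (hroot : ∀ i, ([] : Node) ∈ f i) :
    treeProb p (graft k f) = p k * ∏ i, treeProb p (f i) := by
  rw [treeProb, finprod_mem_graft hf, deg_graft_nil hroot]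
  simp only [deg_graft_cons, treeProb]

theorem cylProb_eq_treeProb (p : PMF ℕ) {t : Set Node} {N : ℕ} (h : ∀ u ∈ t, u.length < N) :
    cylProb p N t = treeProb p t := by
  rw [cylProb, treeProb, Set.sep_eq_self_iff_mem_true.2 h]

/-- The product of a functional `G` over the subtrees of `t` above height `h`. -/
noncomputable def forestProd (G : Set Node → ℝ≥0∞) (h : ℕ) (t : Set Node) : ℝ≥0∞ :=
  ∏ᶠ u ∈ {u ∈ t | u.length = h}, G (subtreeAt t u)

theorem IsTree.forestProd_zero {t : Set Node} (ht : IsTree t) (G : Set Node → ℝ≥0∞) :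
    forestProd G 0 t = G t := by
  rw [forestProd, ht.length_eq_zero, finprod_mem_singleton, subtreeAt_nil]

theorem forestProd_succ_graft (G : Set Node → ℝ≥0∞) (h : ℕ) {k : ℕ} {f : Fin k → Set Node}
    (hf : ∀ i, (f i).Finite) :
    forestProd G (h + 1) (graft k f) = ∏ i, forestProd G h (f i) := by
  rw [forestProd, graft_length_eq_succ,
    finprod_mem_branches fun i => (hf i).subset (Set.sep_subset _ _)]
  simp only [subtreeAt_graft, forestProd]

/-! ### Sums over finite trees -/

/-- The set of finite trees. -/
abbrev FiniteTree : Type := {t : Set Node // IsTree t ∧ t.Finite}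

instance : Countable FiniteTree := by
  have : {t : Set Node | t.Finite}.Countable := by
    simpa using Set.countable_ofPred_finite_subset (s := (Set.univ : Set Node)) Set.countable_univ
  exact (this.mono fun t (ht : IsTree t ∧ t.Finite) => ht.2).to_subtype

/-- Decomposition of a finite tree at its root. -/
noncomputable def rootEquiv : (Σ k : ℕ, (Fin k → FiniteTree)) ≃ FiniteTree where
  toFun x := ⟨graft x.1 fun i => (x.2 i).1,
    IsTree.graft fun i => (x.2 i).2.1, finite_graft fun i => (x.2 i).2.2⟩
  invFun s := ⟨deg s.1 [], fun i => ⟨subtreeAt s.1 [Nat.succPNat i],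
    s.2.1.subtreeAt (s.2.1.singleton_mem i), finite_subtreeAt s.2.2 _⟩⟩
  left_inv x := by
    obtain ⟨k, f⟩ := x
    have key : ∀ m (e : m = k),
        (⟨m, fun i => ⟨subtreeAt (graft k fun i => (f i).1) [Nat.succPNat i],
          (IsTree.graft fun i => (f i).2.1).subtreeAt
            (succPNat_cons_mem_graft (i := Fin.cast e i).2 (f _).2.1.1),
          finite_subtreeAt (finite_graft fun i => (f i).2.2) _⟩⟩ :
          Σ k : ℕ, (Fin k → FiniteTree)) = ⟨k, f⟩ := by
      rintro m rfl
      congr 1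
      funext i
      exact Subtype.ext (subtreeAt_graft m (fun i => (f i).1) i [])
    exact key _ (deg_graft_nil fun i => (f i).2.1.1)
  right_inv s := Subtype.ext s.2.1.graft_subtreeAt

theorem coe_rootEquiv (k : ℕ) (f : Fin k → FiniteTree) :
    (rootEquiv ⟨k, f⟩).1 = graft k fun i => (f i).1 := rfl

theorem tsum_finiteTree (F : FiniteTree → ℝ≥0∞) :
    ∑' s, F s = ∑' k : ℕ, ∑' f : Fin k → FiniteTree, F (rootEquiv ⟨k, f⟩) := by
  rw [← rootEquiv.tsum_eq F, ENNReal.tsum_sigma']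

theorem tsum_prod_eq_prod_tsum {ι : Type*} {k : ℕ} (g : Fin k → ι → ℝ≥0∞) :
    ∑' f : Fin k → ι, ∏ i, g i (f i) = ∏ i, ∑' x, g i x := by
  induction k with
  | zero => simp
  | succ k ih =>
    rw [← (Fin.consEquiv fun _ : Fin (k + 1) => ι).tsum_eq]
    simp only [Fin.consEquiv, Equiv.coe_fn_mk, Fin.prod_univ_succ, Fin.cons_zero, Fin.cons_succ]
    rw [ENNReal.tsum_prod (f := fun a (f : Fin k → ι) => g 0 a * ∏ i, g (Fin.succ i) (f i))]
    simp only [ENNReal.tsum_mul_left, ENNReal.tsum_mul_right, ih]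

theorem treeProb_rootEquiv (p : PMF ℕ) (k : ℕ) (f : Fin k → FiniteTree) :
    treeProb p (rootEquiv ⟨k, f⟩).1 = p k * ∏ i, treeProb p (f i).1 := by
  rw [coe_rootEquiv]
  exact treeProb_graft p (fun i => (f i).2.2) fun i => (f i).2.1.1

/-- The total mass of finite trees is a fixed point of the offspring generating function. -/
theorem tsum_treeProb_fixed (p : PMF ℕ) :
    ∑' s : FiniteTree, treeProb p s.1 = ∑' k : ℕ, p k * (∑' s : FiniteTree, treeProb p s.1) ^ k := by
  conv_lhs => rw [tsum_finiteTree]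
  simp only [treeProb_rootEquiv, ENNReal.tsum_mul_left]
  refine tsum_congr fun k => ?_
  rw [tsum_prod_eq_prod_tsum fun _ (s : FiniteTree) => treeProb p s.1]
  simp

theorem one_sub_mul_geom_add_pow {q b : ℝ≥0∞} (h : q + b = 1) (k : ℕ) :
    q * ∑ j ∈ Finset.range k, b ^ j + b ^ k = 1 := by
  induction k with
  | zero => simp
  | succ k ih =>
    calc q * ∑ j ∈ Finset.range (k + 1), b ^ j + b ^ (k + 1)
        = q * ∑ j ∈ Finset.range k, b ^ j + (q + b) * b ^ k := by
          rw [Finset.sum_range_succ]; ring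
      _ = 1 := by rw [h, one_mul, ih]

theorem exists_two_le_of_mean_eq_one {p : PMF ℕ} (hp1 : p 1 < 1) (hcrit : mean p = 1) :
    ∃ k, 2 ≤ k ∧ p k ≠ 0 := by
  by_contra! hzero
  have : mean p = p 1 := by
    rw [mean, tsum_eq_single 1]
    · simp
    · intro k hk
      rcases Nat.lt_or_ge k 2 with h | h
      · have : k = 0 := by omega
        simp [this]
      · simp [hzero k h]
  exact hp1.ne (this ▸ hcrit)

theorem eq_one_of_generating_fixed {p : PMF ℕ} (hp1 : p 1 < 1) (hcrit : mean p = 1)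
    {e : ℝ≥0∞} (he : e ≤ 1) (hfix : e = ∑' k : ℕ, p k * e ^ k) : e = 1 := by
  obtain ⟨m, hm, hpm⟩ := exists_two_le_of_mean_eq_one hp1 hcrit
  by_contra hne
  have hlt : e < 1 := lt_of_le_of_ne he hne
  have hq : 1 - e + e = 1 := tsub_add_cancel_of_le he
  have hq0 : 1 - e ≠ 0 := (tsub_pos_of_lt hlt).ne'
  have hqt : 1 - e ≠ ⊤ := ENNReal.sub_ne_top ENNReal.one_ne_top
  have hgeom : ∀ k, ∑ j ∈ Finset.range k, e ^ j ≤ k := fun k => by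
    simpa using Finset.sum_le_card_nsmul (Finset.range k) (fun j => e ^ j) 1
      fun j _ => pow_le_one₀ (zero_le) he
  have hsplit : (1 - e) * ∑' k : ℕ, p k * ∑ j ∈ Finset.range k, e ^ j + e = 1 := by
    conv_lhs => rw [← ENNReal.tsum_mul_left]; enter [2]; rw [hfix]
    rw [← ENNReal.tsum_add]
    refine (tsum_congr fun k => ?_).trans p.tsum_coe
    conv_rhs => rw [← mul_one (p k), ← one_sub_mul_geom_add_pow hq k]
    ring
  have hone : ∑' k : ℕ, p k * ∑ j ∈ Finset.range k, e ^ j = 1 := by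
    have h1 : (1 - e) * ∑' k : ℕ, p k * ∑ j ∈ Finset.range k, e ^ j = (1 - e) * 1 := by
      rw [mul_one]
      exact (ENNReal.eq_sub_of_add_eq hlt.ne_top hsplit)
    exact (ENNReal.mul_right_inj hq0 hqt).1 h1
  have hstrict : ∑' k : ℕ, p k * ∑ j ∈ Finset.range k, e ^ j < ∑' k : ℕ, (k : ℝ≥0∞) * p k := by
    refine ENNReal.tsum_lt_tsum (i := m) ?_ (fun k => ?_) ?_
    · rw [hone]; exact ENNReal.one_ne_top
    · rw [mul_comm]
      gcongr
      exact hgeom k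
    · rw [mul_comm]
      refine (ENNReal.mul_lt_mul_iff_left hpm (p.apply_ne_top m)).2 ?_
      obtain ⟨n, rfl⟩ : ∃ n, m = n + 2 := ⟨m - 2, by omega⟩
      calc ∑ j ∈ Finset.range (n + 2), e ^ j
          = ∑ j ∈ Finset.range n, e ^ (j + 2) + e + 1 := by
            rw [Finset.sum_range_succ', Finset.sum_range_succ']; simp
        _ ≤ n + e + 1 := by
            gcongr
            simpa using Finset.sum_le_card_nsmul (Finset.range n) (fun j => e ^ (j + 2)) 1
              fun j _ => pow_le_one₀ (zero_le) he
        _ < n + 1 + 1 := by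
            refine ENNReal.add_lt_add_right ENNReal.one_ne_top ?_
            exact ENNReal.add_lt_add_left (ENNReal.natCast_ne_top n) hlt
        _ = ((n + 2 : ℕ) : ℝ≥0∞) := by push_cast; ring
  rw [hone] at hstrict
  exact hstrict.ne (hcrit ▸ rfl)

/-- Conservation of the expected size of the generations. -/
theorem tsum_Y_mul_treeProb {p : PMF ℕ} (hcrit : mean p = 1)
    (htot : ∑' s : FiniteTree, treeProb p s.1 = 1) (h : ℕ) :
    ∑' s : FiniteTree, (Y h s.1 : ℝ≥0∞) * treeProb p s.1 = 1 := by
  induction h with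
  | zero =>
    rw [← htot]
    exact tsum_congr fun s => by rw [s.2.1.Y_zero]; simp
  | succ h ih =>
    rw [tsum_finiteTree, ← hcrit, mean]
    refine tsum_congr fun k => ?_
    have hterm : ∀ f : Fin k → FiniteTree,
        (Y (h + 1) (rootEquiv ⟨k, f⟩).1 : ℝ≥0∞) * treeProb p (rootEquiv ⟨k, f⟩).1 =
          p k * ∑ i, ∏ j, (if j = i then (Y h (f j).1 : ℝ≥0∞) else 1) * treeProb p (f j).1 := by
      intro f
      rw [treeProb_rootEquiv, coe_rootEquiv, Y_succ_graft h fun i => (f i).2.2]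
      push_cast
      rw [mul_left_comm, Finset.sum_mul]
      simp only [Finset.prod_mul_distrib, Finset.prod_ite_eq', Finset.mem_univ, if_true]
    simp only [hterm, ENNReal.tsum_mul_left]
    rw [Summable.tsum_finsetSum fun i _ => ENNReal.summable, mul_comm]
    congr 1
    have : ∀ i : Fin k, ∑' f : Fin k → FiniteTree,
        ∏ j, (if j = i then (Y h (f j).1 : ℝ≥0∞) else 1) * treeProb p (f j).1 = 1 := by
      intro i
      rw [tsum_prod_eq_prod_tsum fun j (s : FiniteTree) =>
        (if j = i then (Y h s.1 : ℝ≥0∞) else 1) * treeProb p s.1]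
      refine Finset.prod_eq_one fun j _ => ?_
      by_cases hj : j = i
      · simpa [hj] using ih
      · simpa [hj] using htot
    simp only [this]
    simp

open Classical in
/-- The branching property: given its restriction below height `h`, the subtrees of a GW tree
above height `h` are independent copies of the tree. -/
theorem tsum_restrict_forestProd (p : PMF ℕ) (G : Set Node → ℝ≥0∞) (h : ℕ) (t : FiniteTree)
    (ht : restrict h t.1 = t.1) :
    ∑' s : FiniteTree, (if restrict h s.1 = t.1 then treeProb p s.1 * forestProd G h s.1 else 0) =
      cylProb p h t.1 * (∑' s : FiniteTree, treeProb p s.1 * G s.1) ^ Y h t.1 := by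
  induction h generalizing t with
  | zero =>
    have hzero : ∀ s : FiniteTree, restrict 0 s.1 = {[]} := fun s => by
      simpa [restrict] using s.2.1.length_eq_zero
    rw [t.2.1.Y_zero, pow_one, cylProb]
    rw [hzero] at ht
    simp only [hzero, ← ht, if_true, not_lt_zero, and_false, Set.ofPred_false,
      finprod_mem_empty, one_mul]
    exact tsum_congr fun s => by rw [s.2.1.forestProd_zero]
  | succ h ih =>
    obtain ⟨⟨k, g⟩, rfl⟩ := rootEquiv.surjective t
    have hg : ∀ i, restrict h (g i).1 = (g i).1 := by
      rw [coe_rootEquiv, restrict_graft] at ht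
      exact congrFun (graft_injective k ht)
    rw [tsum_finiteTree, tsum_eq_single k]
    · have hterm : ∀ f : Fin k → FiniteTree,
          (if restrict (h + 1) (rootEquiv ⟨k, f⟩).1 = (rootEquiv ⟨k, g⟩).1 then
            treeProb p (rootEquiv ⟨k, f⟩).1 * forestProd G (h + 1) (rootEquiv ⟨k, f⟩).1 else 0) =
          p k * ∏ i, if restrict h (f i).1 = (g i).1 then
            treeProb p (f i).1 * forestProd G h (f i).1 else 0 := by
        intro f
        rw [treeProb_rootEquiv]
        simp only [coe_rootEquiv, restrict_graft,
          (graft_injective k).eq_iff, funext_iff]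
        rw [Fintype.prod_ite_zero, forestProd_succ_graft G h fun i => (f i).2.2, mul_ite, mul_zero,
          Finset.prod_mul_distrib, mul_assoc]
        congr
      simp only [hterm, ENNReal.tsum_mul_left]
      rw [tsum_prod_eq_prod_tsum fun i (s : FiniteTree) => if restrict h s.1 = (g i).1 then
            treeProb p s.1 * forestProd G h s.1 else 0]
      simp only [ih _ (hg _)]
      rw [coe_rootEquiv, cylProb_succ_graft p h (fun i => (g i).2.2) fun i => (g i).2.1.1,
        Y_succ_graft h fun i => (g i).2.2, Finset.prod_mul_distrib, Finset.prod_pow_eq_pow_sum,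
        mul_assoc]
    · intro m hm
      simp only [ENNReal.tsum_eq_zero]
      intro f
      refine if_neg fun heq => hm ?_
      rw [coe_rootEquiv, coe_rootEquiv, restrict_graft] at heq
      rw [← deg_graft_nil fun i => ((f i).2.1.restrict h).1, heq,
        deg_graft_nil fun i => (g i).2.1.1]

/-! ### The law of a critical Galton–Watson tree -/

theorem IsGW.measurableSet_restrict_eq {Ω : Type*} [MeasurableSpace Ω] {P : Measure Ω}
    {p : PMF ℕ} {τ : Ω → Set Node} (hGW : IsGW P p τ) (h : ℕ) (t : Set Node) :
    MeasurableSet {ω | restrict h (τ ω) = t} :=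
  @Measurable.comp Ω (Set Node) Prop _ treeσ _ (fun s => restrict h s = t) τ
    (@measurableSet_setOfPred _ treeσ _ |>.1 (MeasurableSpace.measurableSet_generateFrom ⟨h, t, rfl⟩))
    hGW.2.1 |> measurableSet_setOfPred.2

theorem IsGW.exists_setOf_eq {Ω : Type*} [MeasurableSpace Ω] {P : Measure Ω}
    {p : PMF ℕ} {τ : Ω → Set Node} (hGW : IsGW P p τ) (s : FiniteTree) :
    ∃ N, 1 ≤ N ∧ (∀ u ∈ s.1, u.length < N) ∧
      {ω | τ ω = s.1} = {ω | restrict N (τ ω) = s.1} := by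
  obtain ⟨N, hN⟩ := exists_length_lt s.2.2
  refine ⟨N, hN _ s.2.1.1, hN, ?_⟩
  ext ω
  constructor
  · intro (hω : τ ω = s.1)
    change restrict N (τ ω) = s.1
    rw [hω, restrict_eq_self]
    exact fun u hu => (hN u hu).le
  · exact fun hω => (hGW.1 ω).eq_of_restrict_eq hN hω

theorem IsGW.measurableSet_eq {Ω : Type*} [MeasurableSpace Ω] {P : Measure Ω}
    {p : PMF ℕ} {τ : Ω → Set Node} (hGW : IsGW P p τ) (s : FiniteTree) :
    MeasurableSet {ω | τ ω = s.1} := by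
  obtain ⟨N, -, -, h⟩ := hGW.exists_setOf_eq s
  exact h ▸ hGW.measurableSet_restrict_eq N s.1

theorem IsGW.measure_eq {Ω : Type*} [MeasurableSpace Ω] {P : Measure Ω}
    {p : PMF ℕ} {τ : Ω → Set Node} (hGW : IsGW P p τ) (s : FiniteTree) :
    P {ω | τ ω = s.1} = treeProb p s.1 := by
  obtain ⟨N, h1, hN, h⟩ := hGW.exists_setOf_eq s
  rw [h, hGW.2.2 N h1 s.1 s.2.1 (height_le_iff.2 fun u hu => (hN u hu).le),
    cylProb_eq_treeProb p hN]

/-- The event that `τ` is a finite tree satisfying `Q`. -/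
def finiteEvent {Ω : Type*} (τ : Ω → Set Node) (Q : Set Node → Prop) : Set Ω :=
  ⋃ s : FiniteTree, {ω | τ ω = s.1 ∧ Q s.1}

theorem mem_finiteEvent {Ω : Type*} {τ : Ω → Set Node} (hτ : ∀ ω, IsTree (τ ω))
    {Q : Set Node → Prop} {ω : Ω} : ω ∈ finiteEvent τ Q ↔ (τ ω).Finite ∧ Q (τ ω) := by
  simp only [finiteEvent, Set.mem_iUnion]
  constructor
  · rintro ⟨s, hs, hQ⟩
    rw [hs]
    exact ⟨s.2.2, hQ⟩
  · rintro ⟨hf, hQ⟩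
    exact ⟨⟨τ ω, hτ ω, hf⟩, rfl, hQ⟩

theorem IsGW.measurableSet_finiteEvent {Ω : Type*} [MeasurableSpace Ω] {P : Measure Ω}
    {p : PMF ℕ} {τ : Ω → Set Node} (hGW : IsGW P p τ) (Q : Set Node → Prop) :
    MeasurableSet (finiteEvent τ Q) :=
  MeasurableSet.iUnion fun s => (hGW.measurableSet_eq s).inter (MeasurableSet.const (Q s.1))

theorem IsGW.measure_finiteEvent {Ω : Type*} [MeasurableSpace Ω] {P : Measure Ω}
    {p : PMF ℕ} {τ : Ω → Set Node} (hGW : IsGW P p τ) (Q : Set Node → Prop) [DecidablePred Q] :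
    P (finiteEvent τ Q) = ∑' s : FiniteTree, if Q s.1 then treeProb p s.1 else 0 := by
  rw [finiteEvent, measure_iUnion]
  · refine tsum_congr fun s => ?_
    split_ifs with hQ
    · simp only [hQ, and_true, hGW.measure_eq s]
    · simp [hQ]
  · intro s s' hs
    rw [Function.onFun, Set.disjoint_left]
    rintro ω ⟨h, -⟩ ⟨h', -⟩
    exact hs (Subtype.ext (h.symm.trans h'))
  · exact fun s => (hGW.measurableSet_eq s).inter (MeasurableSet.const (Q s.1))

/-- A critical GW tree is almost surely finite. -/
theorem IsGW.tsum_treeProb {Ω : Type*} [MeasurableSpace Ω] {P : Measure Ω}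
    [IsProbabilityMeasure P] {p : PMF ℕ} (hp1 : p 1 < 1) (hcrit : mean p = 1)
    {τ : Ω → Set Node} (hGW : IsGW P p τ) :
    ∑' s : FiniteTree, treeProb p s.1 = 1 := by
  refine eq_one_of_generating_fixed hp1 hcrit ?_ (tsum_treeProb_fixed p)
  have := hGW.measure_finiteEvent fun _ => True
  simp only [if_true] at this
  rw [← this]
  exact prob_le_one

theorem IsGW.measure_setOf {Ω : Type*} [MeasurableSpace Ω] {P : Measure Ω}
    [IsProbabilityMeasure P] {p : PMF ℕ} (hp1 : p 1 < 1) (hcrit : mean p = 1)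
    {τ : Ω → Set Node} (hGW : IsGW P p τ) (Q : Set Node → Prop) [DecidablePred Q] :
    P {ω | Q (τ ω)} = ∑' s : FiniteTree, if Q s.1 then treeProb p s.1 else 0 := by
  rw [← hGW.measure_finiteEvent Q]
  have hone : P (finiteEvent τ fun _ => True) = 1 := by
    rw [hGW.measure_finiteEvent]
    simpa using hGW.tsum_treeProb hp1 hcrit
  have hae : ∀ᵐ ω ∂P, ω ∈ finiteEvent τ fun _ => True :=
    (mem_ae_iff_prob_eq_one (hGW.measurableSet_finiteEvent _)).2 hone
  refine measure_congr (hae.mono fun ω hω => propext ?_)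
  rw [mem_finiteEvent hGW.1] at hω
  change Q (τ ω) ↔ ω ∈ finiteEvent τ Q
  rw [mem_finiteEvent hGW.1]
  exact ⟨fun h => ⟨hω.1, h⟩, fun h => h.2⟩

theorem IsGW.tendsto_measure_lt {Ω : Type*} [MeasurableSpace Ω] {P : Measure Ω}
    [IsProbabilityMeasure P] {p : PMF ℕ} (hp1 : p 1 < 1) (hcrit : mean p = 1)
    {τ : Ω → Set Node} (hGW : IsGW P p τ) (A : Set Node → ℕ) :
    Tendsto (fun n : ℕ => P {ω | n < A (τ ω)}) atTop (𝓝 0) := by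
  have hcongr : ∀ n : ℕ, P {ω | n < A (τ ω)} = P (finiteEvent τ fun t => n < A t) := fun n => by
    rw [hGW.measure_finiteEvent, ← hGW.measure_setOf hp1 hcrit fun t => n < A t]
  simp only [hcongr]
  have hlim := tendsto_measure_iInter_atTop (μ := P) (s := fun n : ℕ => finiteEvent τ fun t => n < A t)
    (fun n => (hGW.measurableSet_finiteEvent _).nullMeasurableSet)
    (fun m n hmn ω hω => by
      rw [mem_finiteEvent hGW.1] at hω ⊢
      exact ⟨hω.1, hmn.trans_lt hω.2⟩) ⟨0, measure_ne_top P _⟩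
  have hempty : ⋂ n : ℕ, finiteEvent τ (fun t => n < A t) = ∅ := by
    refine Set.eq_empty_of_forall_notMem fun ω hω => ?_
    exact lt_irrefl _ ((mem_finiteEvent hGW.1).1 (Set.mem_iInter.1 hω (A (τ ω)))).2
  rwa [hempty, measure_empty] at hlim

/-! ### Convergence -/

/-- A Scheffé-type lemma: subprobability weights bounded below by weights converging pointwise
to a probability distribution converge pointwise to it. -/
theorem tendsto_of_le_of_tsum_le_one {ι : Type*} {a l : ℕ → ι → ℝ≥0∞} {c : ι → ℝ≥0∞}
    (hle : ∀ n i, l n i ≤ a n i) (hl : ∀ i, Tendsto (fun n => l n i) atTop (𝓝 (c i)))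
    (ha : ∀ n, ∑' i, a n i ≤ 1) (hc : ∑' i, c i = 1) (i : ι) :
    Tendsto (fun n => a n i) atTop (𝓝 (c i)) := by
  classical
  set r : ℝ≥0∞ := ∑' j, if j = i then 0 else c j with hr
  have hsplit : c i + r = 1 := by rw [← hc, ENNReal.tsum_eq_add_tsum_ite i]
  have hrt : r ≠ ⊤ := ne_top_of_le_ne_top ENNReal.one_ne_top (hsplit ▸ le_add_self)
  have hfatou : r ≤ liminf (fun n => ∑' j, if j = i then 0 else a n j) atTop := by
    let _ : MeasurableSpace ι := ⊤
    have := lintegral_liminf_le (μ := Measure.count) (u := atTop)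
      (f := fun (n : ℕ) (j : ι) => if j = i then 0 else a n j) fun _ => measurable_from_top
    simp only [lintegral_count] at this
    refine le_trans (ENNReal.tsum_le_tsum fun j => ?_) this
    split_ifs with hj
    · exact zero_le
    · rw [← (hl j).liminf_eq]
      exact liminf_le_liminf (Eventually.of_forall fun n => hle n j)
  have hle1 : ∀ n, a n i ≤ 1 := fun n => (ENNReal.le_tsum i).trans (ha n)
  have hrest : r ≤ 1 - limsup (fun n => a n i) atTop := by
    rw [← ENNReal.liminf_const_sub _ _ ENNReal.one_ne_top]
    refine hfatou.trans (liminf_le_liminf (Eventually.of_forall fun n => ?_))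
    refine ENNReal.le_sub_of_add_le_left (ne_top_of_le_ne_top ENNReal.one_ne_top (hle1 n)) ?_
    rw [← ENNReal.tsum_eq_add_tsum_ite i]
    exact ha n
  refine tendsto_of_le_liminf_of_limsup_le ?_ ?_
  · rw [← (hl i).liminf_eq]
    exact liminf_le_liminf (Eventually.of_forall fun n => hle n i)
  · have hL : limsup (fun n => a n i) atTop ≤ 1 :=
      limsup_le_of_le (by isBoundedDefault) (Eventually.of_forall hle1)
    have hsum : limsup (fun n => a n i) atTop + r ≤ c i + r := by
      rw [hsplit, ← add_tsub_cancel_of_le hL]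
      gcongr
    exact (ENNReal.add_le_add_iff_right hrt).1 hsum

theorem restrict_restrict (h : ℕ) (t : Set Node) : restrict h (restrict h t) = restrict h t :=
  restrict_eq_self.2 fun _ hu => hu.2

theorem Y_restrict (h : ℕ) (t : Set Node) : Y h (restrict h t) = Y h t := by
  have : {u ∈ restrict h t | u.length = h} = {u ∈ t | u.length = h} :=
    Set.ext fun u => ⟨fun hu => ⟨hu.1.1, hu.2⟩, fun hu => ⟨⟨hu.1, hu.2.le⟩, hu.2⟩⟩
  rw [Y, this, Y]

open Classical in
theorem tsum_restrict_treeProb {p : PMF ℕ} (htot : ∑' s : FiniteTree, treeProb p s.1 = 1)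
    (h : ℕ) (t : FiniteTree) (ht : restrict h t.1 = t.1) :
    ∑' s : FiniteTree, (if restrict h s.1 = t.1 then treeProb p s.1 else 0) =
      cylProb p h t.1 := by
  have := tsum_restrict_forestProd p (fun _ => 1) h t ht
  simpa [forestProd, htot] using this

open Classical in
/-- If one of the subtrees above height `h` has `A > n` then so has the whole tree. -/
theorem cylProb_mul_le_tsum {p : PMF ℕ} (htot : ∑' s : FiniteTree, treeProb p s.1 = 1)
    {A : Set Node → ℕ}
    (hmono : ∀ t : Set Node, IsTree t → t.Finite → ∀ b : ℕ, 1 ≤ b →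
      ∀ u ∈ t, u.length = b → A (subtreeAt t u) ≤ A t)
    {h : ℕ} (hh : 1 ≤ h) (t : FiniteTree) (ht : restrict h t.1 = t.1) (n : ℕ) {q b : ℝ≥0∞}
    (hb : b = ∑' s : FiniteTree, if A s.1 ≤ n then treeProb p s.1 else 0) (hqb : q + b = 1) :
    q * (cylProb p h t.1 * ∑ j ∈ Finset.range (Y h t.1), b ^ j) ≤
      ∑' s : FiniteTree, if restrict h s.1 = t.1 ∧ n < A s.1 then treeProb p s.1 else 0 := by
  set G : Set Node → ℝ≥0∞ := fun s => if A s ≤ n then 1 else 0 with hG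
  have hbranch := tsum_restrict_forestProd p G h t ht
  have hGb : ∑' s : FiniteTree, treeProb p s.1 * G s.1 = b := by
    rw [hb]
    simp only [hG, mul_ite, mul_one, mul_zero]
  rw [hGb] at hbranch
  have hcyl : cylProb p h t.1 ≤ 1 := by
    rw [← tsum_restrict_treeProb htot h t ht, ← htot]
    refine ENNReal.tsum_le_tsum fun s => ?_
    split_ifs
    · exact le_rfl
    · exact zero_le
  have hfin : cylProb p h t.1 * b ^ Y h t.1 ≠ ⊤ :=
    ENNReal.mul_ne_top (ne_top_of_le_ne_top ENNReal.one_ne_top hcyl)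
      (ENNReal.pow_ne_top (ne_top_of_le_ne_top ENNReal.one_ne_top (hqb ▸ le_add_self)))
  refine (ENNReal.add_le_add_iff_right hfin).1 ?_
  calc q * (cylProb p h t.1 * ∑ j ∈ Finset.range (Y h t.1), b ^ j) +
          cylProb p h t.1 * b ^ Y h t.1
      = cylProb p h t.1 * (q * ∑ j ∈ Finset.range (Y h t.1), b ^ j + b ^ Y h t.1) := by ring
    _ = ∑' s : FiniteTree, (if restrict h s.1 = t.1 then treeProb p s.1 else 0) := by
      rw [one_sub_mul_geom_add_pow hqb, mul_one, tsum_restrict_treeProb htot h t ht]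
    _ ≤ ∑' s : FiniteTree,
          ((if restrict h s.1 = t.1 ∧ n < A s.1 then treeProb p s.1 else 0) +
            if restrict h s.1 = t.1 then treeProb p s.1 * forestProd G h s.1 else 0) := by
      refine ENNReal.tsum_le_tsum fun s => ?_
      by_cases hr : restrict h s.1 = t.1
      · by_cases hA : n < A s.1
        · simp [hr, hA]
        · have hone : forestProd G h s.1 = 1 := by
            refine finprod_mem_of_eqOn_one fun u hu => if_pos ?_
            exact (hmono s.1 s.2.1 s.2.2 h hh u hu.1 hu.2).trans (not_lt.1 hA)
          simp [hr, hA, hone]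
      · simp [hr]
    _ = _ := by rw [ENNReal.tsum_add, hbranch]

/-- **Theorem (tail version of local convergence of conditioned critical GW trees).**
Let `τ` be a critical GW tree with offspring distribution `p`, and `A : 𝕋₀ → ℤ₊` a
functional which is monotone under passing to subtrees above any height `b ≥ 1`.
If `P[A(τ) > n] > 0` for all `n`, then `τ` conditioned on `{A(τ) > n}` converges locally
in distribution, as `n → ∞`, to Kesten's immortal tree `τ*`. -/
theorem gw_tail_local_convergence
    {Ω : Type*} [MeasurableSpace Ω] (P : Measure Ω) [IsProbabilityMeasure P]
    (p : PMF ℕ) (hp1 : p 1 < 1) (hcrit : mean p = 1)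
    (τ : Ω → Set Node) (hGW : IsGW P p τ)
    (A : Set Node → ℕ)
    (hmono : ∀ t : Set Node, IsTree t → t.Finite → ∀ b : ℕ, 1 ≤ b →
      ∀ u ∈ t, u.length = b → A (subtreeAt t u) ≤ A t)
    (hpos : ∀ n : ℕ, P {ω | n < A (τ ω)} ≠ 0) :
    ∀ h : ℕ, 1 ≤ h → ∀ t : Set Node, IsTree t → height t ≤ (h : ℕ∞) →
      Tendsto
        (fun n : ℕ =>
          P ({ω | restrict h (τ ω) = t} ∩ {ω | n < A (τ ω)}) / P {ω | n < A (τ ω)})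
        atTop (𝓝 (kesten p h t)) := by
  classical
  intro h hh t htree hheight
  have hlen := height_le_iff.1 hheight
  have htot := hGW.tsum_treeProb hp1 hcrit
  set q : ℕ → ℝ≥0∞ := fun n => P {ω | n < A (τ ω)} with hq
  have hqsum : ∀ n, q n = ∑' s : FiniteTree, if n < A s.1 then treeProb p s.1 else 0 :=
    fun n => hGW.measure_setOf hp1 hcrit fun s => n < A s
  have hqtop : ∀ n, q n ≠ ⊤ := fun n => measure_ne_top P _
  set b : ℕ → ℝ≥0∞ := fun n => ∑' s : FiniteTree, if A s.1 ≤ n then treeProb p s.1 else 0 with hb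
  have hqb : ∀ n, q n + b n = 1 := by
    intro n
    rw [hqsum, hb, ← ENNReal.tsum_add, ← htot]
    refine tsum_congr fun s => ?_
    by_cases hA : n < A s.1
    · simp [hA, not_le.2 hA]
    · simp [hA, not_lt.1 hA]
  have hblim : Tendsto b atTop (𝓝 1) := by
    have hbq : b = fun n => 1 - q n := by
      funext n
      rw [← hqb n, ENNReal.add_sub_cancel_left (hqtop n)]
    rw [hbq]
    simpa using ENNReal.Tendsto.sub tendsto_const_nhds (hGW.tendsto_measure_lt hp1 hcrit A)
      (Or.inl ENNReal.one_ne_top)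
  set mass : FiniteTree → ℝ≥0∞ := fun t =>
    ∑' s : FiniteTree, if restrict h s.1 = t.1 then treeProb p s.1 else 0 with hmass
  set a : ℕ → FiniteTree → ℝ≥0∞ := fun n t =>
    (∑' s : FiniteTree, if restrict h s.1 = t.1 ∧ n < A s.1 then treeProb p s.1 else 0) / q n
    with ha
  set l : ℕ → FiniteTree → ℝ≥0∞ := fun n t =>
    mass t * ∑ j ∈ Finset.range (Y h t.1), b n ^ j with hl
  let restr : FiniteTree → FiniteTree := fun s =>
    ⟨restrict h s.1, s.2.1.restrict h, s.2.2.subset (Set.sep_subset _ _)⟩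
  have hrestr : ∀ s r : FiniteTree, restrict h s.1 = r.1 ↔ r = restr s := fun s r =>
    ⟨fun H => Subtype.ext H.symm, fun H => (congrArg Subtype.val H).symm⟩
  have hmass_le : ∀ r, mass r ≤ 1 := by
    intro r
    rw [← htot]
    refine ENNReal.tsum_le_tsum fun s => ?_
    split_ifs
    · exact le_rfl
    · exact zero_le
  have hla : ∀ n r, l n r ≤ a n r := by
    intro n r
    by_cases hr : restrict h r.1 = r.1
    · rw [ha, ENNReal.le_div_iff_mul_le (Or.inl (hpos n)) (Or.inl (hqtop n)), mul_comm]
      simp only [hl, hmass]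
      rw [tsum_restrict_treeProb htot h r hr]
      exact cylProb_mul_le_tsum htot hmono hh r hr n rfl (hqb n)
    · have hzero : mass r = 0 := by
        simp only [hmass, ENNReal.tsum_eq_zero]
        refine fun s => if_neg fun hs => hr ?_
        rw [← hs, restrict_restrict]
      simp only [hl, hzero, zero_mul]
      exact zero_le
  have hllim : ∀ r, Tendsto (fun n => l n r) atTop (𝓝 (mass r * Y h r.1)) := by
    intro r
    refine ENNReal.Tendsto.const_mul ?_
      (Or.inr (ne_top_of_le_ne_top ENNReal.one_ne_top (hmass_le r)))
    have : Tendsto (fun n => ∑ j ∈ Finset.range (Y h r.1), b n ^ j) atTop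
        (𝓝 (∑ j ∈ Finset.range (Y h r.1), 1 ^ j)) :=
      tendsto_finsetSum _ fun j _ => ENNReal.Tendsto.pow hblim
    simpa using this
  have hasum : ∀ n, ∑' r, a n r ≤ 1 := by
    intro n
    simp only [ha, div_eq_mul_inv]
    rw [ENNReal.tsum_mul_right, ENNReal.tsum_comm, ← div_eq_mul_inv]
    refine ENNReal.div_le_of_le_mul ?_
    rw [one_mul, hqsum]
    refine ENNReal.tsum_le_tsum fun s => ?_
    simp only [hrestr, ite_and]
    rw [tsum_ite_eq]
  have hcsum : ∑' r : FiniteTree, mass r * Y h r.1 = 1 := by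
    rw [← tsum_Y_mul_treeProb hcrit htot h]
    simp only [hmass, ← ENNReal.tsum_mul_right]
    rw [ENNReal.tsum_comm]
    refine tsum_congr fun s => ?_
    simp only [hrestr, ite_mul, zero_mul]
    rw [tsum_ite_eq, mul_comm, Y_restrict]
  let t' : FiniteTree := ⟨t, htree, htree.finite_of_length_le hlen⟩
  have hkey := tendsto_of_le_of_tsum_le_one hla hllim hasum hcsum t'
  have hlimit : mass t' * Y h t'.1 = kesten p h t := by
    simp only [hmass]
    rw [tsum_restrict_treeProb htot h t' (restrict_eq_self.2 hlen), kesten, hcrit]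
    simp [t', mul_comm]
  rw [← hlimit]
  refine hkey.congr fun n => ?_
  exact congrArg (· / q n)
    (hGW.measure_setOf hp1 hcrit fun s => restrict h s = t ∧ n < A s).symm

end GWLocal
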